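/- arXiv:1606.06014 — 3 statements merged into one kernel-verified Lean document; each statement's English description precedes it below -/
import Mathlib

section
/- Refining the partition decreases the degree of conservatism: if the partition {Ω'_q}_{q∈Q} refines the partition {Ω_p}_{p∈P} (i.e., every block Ω'_q is contained in some block Ω_p), then for every cost function g : Ω → ℝ, Σ_{q∈Q} ρ'_q · max_{w∈Ω'_q} g(w) ≤ Σ_{p∈P} ρ_p · max_{w∈Ω_p} g(w), where ρ'_q = Σ_{w∈Ω'_q} π(w) and ρ_p = Σ_{w∈Ω_p} π(w). -/
/-- If a family `C` covers the disjoint blocks `B`, and each `C q` lies in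
`B (f q)`, then each `B p` is the union of the blocks `C q` over the fibre of `f` above `p`. -/
theorem biUnion_fiber_eq_of_refinement
    {S ι κ : Type*} [DecidableEq S] [Fintype κ] [DecidableEq ι]
    {B : ι → Finset S} {C : κ → Finset S} {f : κ → ι}
    (hBdisj : ∀ p q : ι, p ≠ q → Disjoint (B p) (B q))
    (hcover : ∀ p, B p ⊆ Finset.univ.biUnion C) (hf : ∀ q, C q ⊆ B (f q)) (p : ι) :
    (Finset.univ.filter fun q => f q = p).biUnion C = B p := by
  ext w
  simp only [Finset.mem_biUnion, Finset.mem_filter, Finset.mem_univ, true_and]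
  constructor
  · rintro ⟨q, rfl, hw⟩
    exact hf q hw
  · intro hw
    obtain ⟨q, -, hq⟩ := Finset.mem_biUnion.mp (hcover p hw)
    refine ⟨q, ?_, hq⟩
    by_contra hne
    exact Finset.disjoint_left.mp (hBdisj _ _ hne) (hf q hq) hw

/-- Refining the partition decreases the degree of conservatism: if the partition
{Ω'_q}_{q∈Q} refines {Ω_p}_{p∈P}, then the hybrid objective of the refined partition is
at most the hybrid objective of the coarser one. -/
theorem hybrid_mono_of_refinement
    {S ι κ : Type*} [DecidableEq S] [Fintype ι] [Fintype κ]
    (Ω : Finset S) (hΩ : Ω.Nonempty)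
    (π : S → ℝ) (hπ : ∀ w ∈ Ω, 0 ≤ π w) (hsum : ∑ w ∈ Ω, π w = 1)
    (B : ι → Finset S) (hBne : ∀ p, (B p).Nonempty)
    (hBdisj : ∀ p q : ι, p ≠ q → Disjoint (B p) (B q))
    (hBcover : Finset.univ.biUnion B = Ω)
    (C : κ → Finset S) (hCne : ∀ q, (C q).Nonempty)
    (hCdisj : ∀ p q : κ, p ≠ q → Disjoint (C p) (C q))
    (hCcover : Finset.univ.biUnion C = Ω)
    (hrefine : ∀ q : κ, ∃ p : ι, C q ⊆ B p)
    (g : S → ℝ) :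
    ∑ q : κ, (∑ w ∈ C q, π w) * (C q).sup' (hCne q) g ≤
      ∑ p : ι, (∑ w ∈ B p, π w) * (B p).sup' (hBne p) g := by
  classical
  choose f hf using hrefine
  have hcover (p : ι) : B p ⊆ Finset.univ.biUnion C := by
    rw [hCcover, ← hBcover]
    exact Finset.subset_biUnion_of_mem B (Finset.mem_univ p)
  have hweight (p : ι) : ∑ w ∈ B p, π w = ∑ q with f q = p, ∑ w ∈ C q, π w := by
    rw [← biUnion_fiber_eq_of_refinement hBdisj hcover hf p]
    exact Finset.sum_biUnion fun q _ r _ hqr => hCdisj q r hqr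
  calc ∑ q : κ, (∑ w ∈ C q, π w) * (C q).sup' (hCne q) g
      ≤ ∑ q : κ, (∑ w ∈ C q, π w) * (B (f q)).sup' (hBne (f q)) g := by
        refine Finset.sum_le_sum fun q _ => mul_le_mul_of_nonneg_left
          (Finset.sup'_mono g (hf q) (hCne q)) (Finset.sum_nonneg fun w hw => hπ w ?_)
        exact hCcover ▸ Finset.mem_biUnion.mpr ⟨q, Finset.mem_univ q, hw⟩
    _ = ∑ p : ι, ∑ q with f q = p, (∑ w ∈ C q, π w) * (B (f q)).sup' (hBne (f q)) g :=
        (Finset.sum_fiberwise _ _ _).symm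
    _ = ∑ p : ι, (∑ w ∈ B p, π w) * (B p).sup' (hBne p) g := by
        refine Finset.sum_congr rfl fun p _ => ?_
        rw [hweight p, Finset.sum_mul]
        refine Finset.sum_congr rfl fun q hq => ?_
        obtain rfl := (Finset.mem_filter.mp hq).2
        rfl
end

section
/- Finite termination of the column-and-constraint generation procedure: suppose (x_i)_{i∈ℕ} in X and nonempty subsets (Ω'_i)_{i∈ℕ} of Ω satisfy, for every i: x_i minimizes the master problem f(x) + max_{w∈Ω'_i} g(x,w) over X, w_i ∈ Ω attains max_{w∈Ω} g(x_i,w), and Ω'_{i+1} = Ω'_i ∪ {w_i}. Then there exists an index i ≤ |Ω| at which w_i ∈ Ω'_i, and at that index the gap is zero: min_{x∈X} [f(x) + max_{w∈Ω'_i} g(x,w)] = f(x_i) + max_{w∈Ω} g(x_i,w), so x_i solves the full robust problem. -/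
/-- If a sequence of subsets of a finite set `Ω` grows by inserting one element at a time, then
within the first `Ω.card + 1` steps some inserted element was already present. -/
theorem exists_mem_of_insert_chain {S : Type*} [DecidableEq S] (Ω : Finset S)
    (A : ℕ → Finset S) (w : ℕ → S) (hsub : ∀ i, A i ⊆ Ω)
    (hupdate : ∀ i, A (i + 1) = insert (w i) (A i)) :
    ∃ i ≤ Ω.card, w i ∈ A i := by
  by_contra! hnew
  have hcard : ∀ n ≤ Ω.card + 1, n ≤ (A n).card := by
    intro n
    induction n with
    | zero => simp
    | succ k ih =>
      intro hk
      rw [hupdate, Finset.card_insert_of_notMem (hnew k (by omega))]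
      have := ih (by omega)
      omega
  have hle := hcard (Ω.card + 1) le_rfl
  have := Finset.card_le_card (hsub (Ω.card + 1))
  omega

/-- Finite termination of the column-and-constraint generation procedure: along the
iterates of the algorithm (master minimizer xᵢ, a global worst-case scenario wᵢ of xᵢ,
and Ω'ᵢ₊₁ = Ω'ᵢ ∪ {wᵢ}), there is an index i ≤ |Ω| at which wᵢ ∈ Ω'ᵢ, and at that index
the gap is zero, so xᵢ solves the full robust problem. -/
theorem ccg_finite_termination
    {S σ : Type*} [DecidableEq S]
    (Ω : Finset S) (hΩ : Ω.Nonempty)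
    (X : Finset σ) (hX : X.Nonempty)
    (f : σ → ℝ) (g : σ → S → ℝ)
    (x : ℕ → σ) (Ωred : ℕ → Finset S) (w : ℕ → S)
    (hne : ∀ i, (Ωred i).Nonempty)
    (hsub : ∀ i, Ωred i ⊆ Ω)
    (hxX : ∀ i, x i ∈ X)
    (hmin : ∀ i, ∀ y ∈ X,
      f (x i) + (Ωred i).sup' (hne i) (g (x i)) ≤ f y + (Ωred i).sup' (hne i) (g y))
    (hwΩ : ∀ i, w i ∈ Ω)
    (hworst : ∀ i, g (x i) (w i) = Ω.sup' hΩ (g (x i)))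
    (hupdate : ∀ i, Ωred (i + 1) = insert (w i) (Ωred i)) :
    ∃ i ≤ Ω.card, w i ∈ Ωred i ∧
      X.inf' hX (fun y => f y + (Ωred i).sup' (hne i) (g y)) =
        f (x i) + Ω.sup' hΩ (g (x i)) ∧
      ∀ y ∈ X, f (x i) + Ω.sup' hΩ (g (x i)) ≤ f y + Ω.sup' hΩ (g y) := by
  obtain ⟨i, hi, hmem⟩ : ∃ i ≤ Ω.card, w i ∈ Ωred i :=
    exists_mem_of_insert_chain Ω Ωred w hsub hupdate
  have hsup : (Ωred i).sup' (hne i) (g (x i)) = Ω.sup' hΩ (g (x i)) :=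
    le_antisymm (Finset.sup'_mono _ (hsub i) (hne i))
      (hworst i ▸ Finset.le_sup' (g (x i)) hmem)
  refine ⟨i, hi, hmem, le_antisymm ?_ ?_, fun y hy => ?_⟩
  · rw [← hsup]
    exact Finset.inf'_le (fun y => f y + (Ωred i).sup' (hne i) (g y)) (hxX i)
  · rw [← hsup]
    exact Finset.le_inf' _ _ (hmin i)
  · rw [← hsup]
    exact (hmin i y hy).trans
      (add_le_add_right (Finset.sup'_mono (g y) (hsub i) (hne i)) (f y))
end

section
/- Exactness of the Scenario Partition and Decomposition Algorithm: suppose for each partition block p ∈ P a nonempty subset Ω'_p ⊆ Ω_p is selected, and x* minimizes the reduced hybrid objective f(x) + Σ_{p∈P} ρ_p · max_{w∈Ω'_p} g(x,w) over X. If for every p ∈ P the reduced set captures the within-block worst case of x*, i.e., max_{w∈Ω'_p} g(x*,w) = max_{w∈Ω_p} g(x*,w), then x* also minimizes the full hybrid objective f(x) + Σ_{p∈P} ρ_p · max_{w∈Ω_p} g(x,w) over X, and the two optimal values coincide. -/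
/-- The infimum of a function over a finite set is its value at a minimizer. -/
theorem Finset.inf'_eq_of_forall_le {σ α : Type*} [LinearOrder α] {X : Finset σ}
    (hX : X.Nonempty) {F : σ → α} {a : σ} (ha : a ∈ X) (hF : ∀ x ∈ X, F a ≤ F x) :
    X.inf' hX F = F a :=
  le_antisymm (Finset.inf'_le F ha) (Finset.le_inf' hX F hF)

/-- A minimizer of a lower bound `F` of `G` at which `F` and `G` agree also minimizes `G`,
and the minimal values coincide. -/
theorem Finset.minimizer_of_tight_lower_bound {σ α : Type*} [LinearOrder α] {X : Finset σ}
    (hX : X.Nonempty) {F G : σ → α} {a : σ} (ha : a ∈ X) (hF : ∀ x ∈ X, F a ≤ F x)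
    (hFG : ∀ x ∈ X, F x ≤ G x) (htight : F a = G a) :
    (∀ x ∈ X, G a ≤ G x) ∧ X.inf' hX F = X.inf' hX G := by
  have hG : ∀ x ∈ X, G a ≤ G x := fun x hx =>
    htight ▸ (hF x hx).trans (hFG x hx)
  refine ⟨hG, ?_⟩
  rw [Finset.inf'_eq_of_forall_le hX ha hF, Finset.inf'_eq_of_forall_le hX ha hG, htight]

/-- Exactness of the Scenario Partition and Decomposition Algorithm: if x* minimizes the
reduced hybrid objective and, for every partition block p, the reduced set Ω'_p captures
the within-block worst case of x*, then x* also minimizes the full hybrid objective and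
the two optimal values coincide. -/
theorem spda_exactness
    {S ι σ : Type*} [DecidableEq S] [Fintype ι]
    (Ω : Finset S) (hΩ : Ω.Nonempty)
    (π : S → ℝ) (hπ : ∀ w ∈ Ω, 0 ≤ π w) (hsum : ∑ w ∈ Ω, π w = 1)
    (B : ι → Finset S) (hBne : ∀ p, (B p).Nonempty)
    (hdisj : ∀ p q : ι, p ≠ q → Disjoint (B p) (B q))
    (hcover : Finset.univ.biUnion B = Ω)
    (B' : ι → Finset S) (hB'ne : ∀ p, (B' p).Nonempty)
    (hB'sub : ∀ p, B' p ⊆ B p)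
    (X : Finset σ) (hX : X.Nonempty)
    (f : σ → ℝ) (g : σ → S → ℝ)
    (xstar : σ) (hxstar : xstar ∈ X)
    (hmin : ∀ x ∈ X,
      f xstar + ∑ p : ι, (∑ w ∈ B p, π w) * (B' p).sup' (hB'ne p) (g xstar) ≤
        f x + ∑ p : ι, (∑ w ∈ B p, π w) * (B' p).sup' (hB'ne p) (g x))
    (hcapture : ∀ p : ι,
      (B' p).sup' (hB'ne p) (g xstar) = (B p).sup' (hBne p) (g xstar)) :
    (∀ x ∈ X,
        f xstar + ∑ p : ι, (∑ w ∈ B p, π w) * (B p).sup' (hBne p) (g xstar) ≤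
          f x + ∑ p : ι, (∑ w ∈ B p, π w) * (B p).sup' (hBne p) (g x)) ∧
      X.inf' hX (fun x => f x + ∑ p : ι, (∑ w ∈ B p, π w) * (B' p).sup' (hB'ne p) (g x)) =
        X.inf' hX (fun x => f x + ∑ p : ι, (∑ w ∈ B p, π w) * (B p).sup' (hBne p) (g x)) := by
  have hρ : ∀ p : ι, 0 ≤ ∑ w ∈ B p, π w := fun p =>
    Finset.sum_nonneg fun w hw =>
      hπ w (hcover ▸ Finset.mem_biUnion.2 ⟨p, Finset.mem_univ p, hw⟩)
  refine Finset.minimizer_of_tight_lower_bound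
    (F := fun x => f x + ∑ p : ι, (∑ w ∈ B p, π w) * (B' p).sup' (hB'ne p) (g x))
    (G := fun x => f x + ∑ p : ι, (∑ w ∈ B p, π w) * (B p).sup' (hBne p) (g x))
    hX hxstar hmin (fun x _ => ?_) ?_
  · exact add_le_add_right (Finset.sum_le_sum fun p _ =>
      mul_le_mul_of_nonneg_left (Finset.sup'_mono (g x) (hB'sub p) (hB'ne p)) (hρ p)) (f x)
  · simp only [hcapture]
end
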